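/- For a discrete concave function g : ℤ⁺ → ℝ, repeatedly replacing the pair (min, max) of a multiset of positive integers of fixed sum by (⌊(min+max)/2⌋, ⌈(min+max)/2⌉) never decreases the sum of g over the multiset, and the sum of elements is preserved. -/

import Mathlib

/-- Moving two points one unit towards each other does not decrease the sum of a discrete
concave function. -/
theorem add_le_add_of_concave_step (g : ℕ → ℝ)
    (hconc : ∀ k : ℕ, 2 ≤ k → g (k - 1) + g (k + 1) ≤ 2 * g k)
    (a : ℕ) (ha : 1 ≤ a) (n : ℕ) :
    g a + g (a + n + 2) ≤ g (a + 1) + g (a + n + 1) := by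
  induction n with
  | zero =>
    have h := hconc (a + 1) (by lia)
    simp only [Nat.add_sub_cancel, add_assoc, Nat.reduceAdd, Nat.add_zero] at h ⊢
    linarith
  | succ n ih =>
    have h : g (a + n + 1) + g (a + n + 3) ≤ 2 * g (a + n + 2) := hconc (a + n + 2) (by lia)
    rw [show a + (n + 1) + 2 = a + n + 3 by lia, show a + (n + 1) + 1 = a + n + 2 by lia]
    linarith

/-- Balancing two points at distance `n` does not decrease the sum of a discrete concave
function. -/
theorem add_le_add_of_concave_balance (g : ℕ → ℝ)
    (hconc : ∀ k : ℕ, 2 ≤ k → g (k - 1) + g (k + 1) ≤ 2 * g k) (n : ℕ) :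
    ∀ a : ℕ, 1 ≤ a →
      g a + g (a + n) ≤ g ((a + (a + n)) / 2) + g ((a + (a + n) + 1) / 2) := by
  induction n using Nat.twoStepInduction with
  | zero =>
    intro a _
    rw [show (a + (a + 0)) / 2 = a by lia, show (a + (a + 0) + 1) / 2 = a by lia, Nat.add_zero]
  | one =>
    intro a _
    rw [show (a + (a + 1)) / 2 = a by lia, show (a + (a + 1) + 1) / 2 = a + 1 by lia]
  | more n ih _ =>
    intro a ha
    have h := ih (a + 1) (by lia)
    rw [show a + 1 + (a + 1 + n) = a + (a + (n + 2)) by lia,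
      show a + 1 + n = a + n + 1 by lia] at h
    exact (add_le_add_of_concave_step g hconc a ha n).trans h

/-- One balancing step on a multiset of positive rates: replacing two elements
`a ≤ b` by `⌊(a+b)/2⌋` and `⌈(a+b)/2⌉` preserves the sum of the elements and does
not decrease the sum of a discrete concave function `g` over the multiset. -/
theorem balancing_step_multiset
    (g : ℕ → ℝ)
    (hconc : ∀ k : ℕ, 2 ≤ k → g (k - 1) + g (k + 1) ≤ 2 * g k)
    (s : Multiset ℕ) (hpos : ∀ x ∈ s, 1 ≤ x)
    (a b : ℕ) (ha : a ∈ s) (hb : b ∈ s.erase a) (hab : a ≤ b)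
    (t : Multiset ℕ)
    (ht : t = ((a + b) / 2) ::ₘ ((a + b + 1) / 2) ::ₘ ((s.erase a).erase b)) :
    t.sum = s.sum ∧ (s.map g).sum ≤ (t.map g).sum := by
  obtain ⟨u, rfl⟩ := Multiset.exists_cons_of_mem ha
  rw [Multiset.erase_cons_head] at hb ht
  obtain ⟨v, rfl⟩ := Multiset.exists_cons_of_mem hb
  rw [Multiset.erase_cons_head] at ht
  subst ht
  obtain ⟨n, rfl⟩ := Nat.exists_eq_add_of_le hab
  have h := add_le_add_of_concave_balance g hconc n a (hpos a ha)
  simp only [Multiset.sum_cons, Multiset.map_cons]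
  exact ⟨by lia, by linarith⟩
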